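/- arXiv:1201.2206 — 3 statements merged into one kernel-verified Lean document; each statement's English description precedes it below -/
import Mathlib

section
/- Let H be a Hilbert space, let A be a bounded linear operator on H and let S be a bounded projection (S² = S) on H. Suppose A + S has a bounded inverse on H. Then A has a bounded inverse on H if and only if the operator B := S − S(A+S)^{−1}S, regarded as an operator on the subspace SH, has a bounded inverse in SH; and in this case A^{−1} = (A+S)^{−1} + (A+S)^{−1} S B^{−1} S (A+S)^{−1}. -/
noncomputable section

section Ring

variable {R : Type*} [Ring R] {A S W : R}

/-- If `A` is invertible, then `S + S A⁻¹ S` is a right inverse of `S - S W S` in the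
corner `S R S`. -/
theorem corner_mul_eq_of_mul_eq_one (hS : S * S = S) (hW : W * (A + S) = 1)
    {Ai : R} (hA : A * Ai = 1) :
    (S - S * W * S) * (S + S * Ai * S) = S := by
  have h : W * S * Ai = Ai - W := by
    calc W * S * Ai = W * (A + S) * Ai - W * (A * Ai) := by noncomm_ring
      _ = Ai - W := by rw [hW, hA, one_mul, mul_one]
  calc (S - S * W * S) * (S + S * Ai * S)
      = S * S + (S * S) * Ai * S - S * W * (S * S) - S * (W * (S * S) * Ai) * S := by
        noncomm_ring
    _ = S := by rw [hS, h]; noncomm_ring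

/-- If `A` is invertible, then `S + S A⁻¹ S` is a left inverse of `S - S W S` in the
corner `S R S`. -/
theorem mul_corner_eq_of_mul_eq_one (hS : S * S = S) (hW : (A + S) * W = 1)
    {Ai : R} (hA : Ai * A = 1) :
    (S + S * Ai * S) * (S - S * W * S) = S := by
  have h : Ai * S * W = Ai - W := by
    calc Ai * S * W = Ai * ((A + S) * W) - (Ai * A) * W := by noncomm_ring
      _ = Ai - W := by rw [hW, hA, one_mul, mul_one]
  calc (S + S * Ai * S) * (S - S * W * S)
      = S * S + S * Ai * (S * S) - (S * S) * W * S - S * (Ai * (S * S) * W) * S := by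
        noncomm_ring
    _ = S := by rw [hS, h]; noncomm_ring

/-- A right inverse of `S - S W S` in the corner `S R S` yields a right inverse of `A`. -/
theorem mul_inversion_formula (hW : (A + S) * W = 1) {B : R}
    (hSB : S * B = B) (hBS : B * S = B) (hB : (S - S * W * S) * B = S) :
    A * (W + W * S * B * S * W) = 1 := by
  have hAW : A * W = 1 - S * W := by
    rw [← hW]; noncomm_ring
  have h : S * W * B = B - S := by
    calc S * W * B = S * B - (S - S * W * S) * B + S * W * (B - S * B) := by noncomm_ring
      _ = B - S := by rw [hB, hSB]; noncomm_ring
  calc A * (W + W * S * B * S * W) = A * W + A * W * ((S * B) * S) * W := by noncomm_ring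
    _ = 1 - S * W + B * W - (S * W * B) * W := by rw [hSB, hBS, hAW]; noncomm_ring
    _ = 1 := by rw [h]; noncomm_ring

/-- A left inverse of `S - S W S` in the corner `S R S` yields a left inverse of `A`. -/
theorem inversion_formula_mul (hW : W * (A + S) = 1) {B : R}
    (hSB : S * B = B) (hBS : B * S = B) (hB : B * (S - S * W * S) = S) :
    (W + W * S * B * S * W) * A = 1 := by
  have hWA : W * A = 1 - W * S := by
    rw [← hW]; noncomm_ring
  have h : B * W * S = B - S := by
    calc B * W * S = B * S - B * (S - S * W * S) + (B - B * S) * W * S := by noncomm_ring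
      _ = B - S := by rw [hB, hBS]; noncomm_ring
  calc (W + W * S * B * S * W) * A = W * A + W * ((S * B) * S) * (W * A) := by noncomm_ring
    _ = 1 - W * S + W * B - W * (B * W * S) := by rw [hSB, hBS, hWA]; noncomm_ring
    _ = 1 := by rw [h]; noncomm_ring

/-- An element of the corner `S R S` absorbs `S` on both sides. -/
theorem mul_eq_self_of_corner (hS : S * S = S) {B : R} (hB : S * B * S = B) :
    S * B = B ∧ B * S = B := by
  constructor
  · rw [← hB, ← mul_assoc, ← mul_assoc, hS]
  · rw [← hB, mul_assoc, hS]

end Ring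

/-- **Lemma 2.1 of Jensen–Nenciu** (Lemma `JNlemma` in the paper).
Let `A` be a bounded operator on a Hilbert space `H` and `S` a bounded projection.
If `A + S` has a bounded inverse `W`, then `A` has a bounded inverse if and only if
`B := S - S W S` has a bounded inverse in `S H`, and in this case
`A⁻¹ = W + W S B⁻¹ S W`. -/
theorem jensen_nenciu_inversion_lemma
    {H : Type*} [NormedAddCommGroup H] [InnerProductSpace ℂ H] [CompleteSpace H]
    (A S : H →L[ℂ] H) (hS : S * S = S)
    (W : H →L[ℂ] H) (hW₁ : (A + S) * W = 1) (hW₂ : W * (A + S) = 1) :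
    ((∃ Ai : H →L[ℂ] H, A * Ai = 1 ∧ Ai * A = 1) ↔
      (∃ B' : H →L[ℂ] H, S * B' * S = B' ∧
        (∀ x : H, (S - S * W * S) (B' (S x)) = S x) ∧
        (∀ x : H, B' ((S - S * W * S) (S x)) = S x))) ∧
    (∀ Ai B' : H →L[ℂ] H, A * Ai = 1 → Ai * A = 1 →
      S * B' * S = B' →
      (∀ x : H, (S - S * W * S) (B' (S x)) = S x) →
      (∀ x : H, B' ((S - S * W * S) (S x)) = S x) →
      Ai = W + W * S * B' * S * W) := by
  have hright : ∀ B' : H →L[ℂ] H, S * B' * S = B' →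
      (∀ x : H, (S - S * W * S) (B' (S x)) = S x) → (S - S * W * S) * B' = S := by
    intro B' hB h
    have h' : (S - S * W * S) * (B' * S) = S := ContinuousLinearMap.ext h
    rwa [(mul_eq_self_of_corner hS hB).2] at h'
  constructor
  · constructor
    · rintro ⟨Ai, h₁, h₂⟩
      have hr := corner_mul_eq_of_mul_eq_one hS hW₂ h₁
      have hl := mul_corner_eq_of_mul_eq_one hS hW₁ h₂
      refine ⟨S + S * Ai * S, ?_, fun x => ?_, fun x => ?_⟩
      · calc S * (S + S * Ai * S) * S = S * S * S + S * S * Ai * (S * S) := by noncomm_ring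
          _ = S + S * Ai * S := by rw [hS, hS]
      · have h : (S - S * W * S) * (S + S * Ai * S) * S = S := by rw [hr, hS]
        exact DFunLike.congr_fun h x
      · have h : (S + S * Ai * S) * (S - S * W * S) * S = S := by rw [hl, hS]
        exact DFunLike.congr_fun h x
    · rintro ⟨B', hB, h₁, h₂⟩
      obtain ⟨hSB, hBS⟩ := mul_eq_self_of_corner hS hB
      have hl : B' * (S - S * W * S) = S := by
        have h : B' * ((S - S * W * S) * S) = S := ContinuousLinearMap.ext h₂
        rwa [sub_mul, mul_assoc (S * W), hS] at h
      exact ⟨W + W * S * B' * S * W, mul_inversion_formula hW₁ hSB hBS (hright B' hB h₁),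
        inversion_formula_mul hW₂ hSB hBS hl⟩
  · intro Ai B' _ hA hB h₁ _
    obtain ⟨hSB, hBS⟩ := mul_eq_self_of_corner hS hB
    exact left_inv_eq_right_inv hA (mul_inversion_formula hW₁ hSB hBS (hright B' hB h₁))
end
end

section
/- Fix λ₁ ∈ (0, 1/2]. For x, x₁ ∈ ℝ² define G(λ,x,x₁) := χ(λ|x−x₁|) J0(λ|x−x₁|) − χ(λ(|x|+1)) J0(λ(|x|+1)). Then for every τ ∈ [0,1] there is a constant C (depending only on τ, χ, λ₁) such that for all 0 < λ ≤ 2λ₁ and all x, x₁ ∈ ℝ²: |G(λ,x,x₁)| ≤ C λ^τ ⟨x₁⟩^τ and |∂_λ G(λ,x,x₁)| ≤ C ⟨x₁⟩^τ λ^{τ−1}. -/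
open MeasureTheory Real Set Complex Filter
open scoped ENNReal ComplexConjugate

noncomputable section

/-- The plane `ℝ²`. -/
abbrev R2 : Type := EuclideanSpace ℝ (Fin 2)

/-- The Bessel function `J₀`, defined by its power series. -/
def J0 (z : ℝ) : ℝ := ∑' k : ℕ, (-1 : ℝ) ^ k * (z / 2) ^ (2 * k) / ((Nat.factorial k : ℝ)) ^ 2

/-- The Bessel function `Y₀`. -/
def Y0 (z : ℝ) : ℝ :=
  (2 / π) * ((Real.log (z / 2) + Real.eulerMascheroniConstant) * J0 z +
    ∑' k : ℕ, (-1 : ℝ) ^ k * ((harmonic (k + 1) : ℝ)) * (z / 2) ^ (2 * (k + 1)) /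
      ((Nat.factorial (k + 1) : ℝ)) ^ 2)

/-- The Hankel functions `H₀^±`; the sign is recorded by `ε = ±1`. -/
def H0 (ε : ℝ) (z : ℝ) : ℂ := (J0 z : ℂ) + (ε : ℂ) * Complex.I * (Y0 z : ℂ)

/-- The Japanese bracket `⟨x⟩ = (1+|x|²)^{1/2}`. -/
def jap (x : R2) : ℝ := Real.sqrt (1 + ‖x‖ ^ 2)

/-- `J₀` is the restriction of an entire function, hence smooth. -/
lemma contDiff_J0 {n : WithTop ℕ∞} : ContDiff ℝ n J0 := by
  let F : ℂ → ℂ := fun w => ∑' k : ℕ,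
    (-1 : ℂ) ^ k * (w / 2) ^ (2 * k) / ((Nat.factorial k : ℂ)) ^ 2
  have hF : Differentiable ℂ F := by
    intro w
    have hball : DifferentiableOn ℂ F (Metric.ball 0 (‖w‖ + 1)) := by
      refine differentiableOn_tsum_of_summable_norm
        (u := fun k : ℕ => (((‖w‖ + 1) / 2) ^ 2) ^ k / (Nat.factorial k : ℝ))
        (Real.summable_pow_div_factorial _) (fun k => by fun_prop) Metric.isOpen_ball ?_
      intro k v hv
      rw [mem_ball_zero_iff] at hv
      have hk : (1 : ℝ) ≤ (Nat.factorial k : ℝ) := by exact_mod_cast Nat.factorial_pos k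
      simp only [norm_div, norm_mul, norm_pow, norm_neg, norm_one, one_pow, one_mul,
        RCLike.norm_natCast, RCLike.norm_ofNat, ← pow_mul]
      gcongr
      nlinarith
    exact (hball w (by simp)).differentiableAt
      (Metric.isOpen_ball.mem_nhds (by simp))
  have hJ : J0 = fun x : ℝ => (F x).re := by
    funext x
    have : F x = ((J0 x : ℝ) : ℂ) := by
      simp only [F, J0]
      push_cast
      rfl
    rw [this, Complex.ofReal_re]
  rw [hJ]
  exact (hF.contDiff (n := n)).real_of_complex

/-- A compactly supported `C¹` function has increments bounded by `M t ^ τ` over distances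
at most `2 t`, for every `τ ∈ [0, 1]`. -/
lemma exists_abs_sub_le_mul_rpow {g : ℝ → ℝ} (hg : ContDiff ℝ 1 g) (hs : HasCompactSupport g)
    {τ : ℝ} (hτ : τ ∈ Icc (0 : ℝ) 1) :
    ∃ M : ℝ, 0 ≤ M ∧ ∀ a b t : ℝ, 0 < t → |a - b| ≤ 2 * t → |g a - g b| ≤ M * t ^ τ := by
  obtain ⟨A, hA⟩ := hs.exists_bound_of_continuous hg.continuous
  obtain ⟨K, hK⟩ := hg.lipschitzWith_of_hasCompactSupport hs one_ne_zero
  have hA0 : 0 ≤ A := (norm_nonneg _).trans (hA 0)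
  have hK0 : (0 : ℝ) ≤ K := K.2
  refine ⟨2 * A + 2 * K, by positivity, fun a b t ht hab => ?_⟩
  rcases le_total 1 t with h | h
  · have h1 : 1 ≤ t ^ τ := Real.one_le_rpow h hτ.1
    have h2 : |g a - g b| ≤ A + A := (norm_sub_le _ _).trans (add_le_add (hA a) (hA b))
    nlinarith
  · have h1 : t ≤ t ^ τ := by
      simpa using Real.rpow_le_rpow_of_exponent_ge ht h hτ.2
    have h2 : |g a - g b| ≤ K * |a - b| := by
      simpa [Real.dist_eq] using hK.dist_le_mul a b
    have h3 : K * |a - b| ≤ K * (2 * t ^ τ) := by gcongr; linarith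
    have h4 : 0 ≤ A * t ^ τ := by positivity
    linarith

lemma abs_dist_sub_norm_add_one_le (x x₁ : R2) : |dist x x₁ - (‖x‖ + 1)| ≤ 2 * jap x₁ := by
  have h1 : 1 ≤ jap x₁ := Real.one_le_sqrt.2 (by nlinarith [sq_nonneg ‖x₁‖])
  have h2 : ‖x₁‖ ≤ jap x₁ := Real.le_sqrt_of_sq_le (by linarith)
  have h3 : dist x x₁ ≤ ‖x‖ + ‖x₁‖ := by rw [dist_eq_norm]; exact norm_sub_le _ _
  have h4 : ‖x‖ - ‖x₁‖ ≤ dist x x₁ := by rw [dist_eq_norm]; exact norm_sub_norm_le _ _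
  rw [abs_le]
  constructor <;> linarith

/-- **Bounds on the auxiliary low-energy function `G`** (part of Lemma `lem:FG` of the paper).
For `G(λ,x,x₁) = χ(λ|x-x₁|)J₀(λ|x-x₁|) - χ(λ(|x|+1))J₀(λ(|x|+1))` one has, for every
`τ ∈ [0,1]`, a constant `C` with `|G(λ,x,x₁)| ≤ C λ^τ ⟨x₁⟩^τ` and
`|∂_λ G(λ,x,x₁)| ≤ C ⟨x₁⟩^τ λ^{τ-1}` for all `0 < λ ≤ 2λ₁`. -/
theorem lowEnergy_G_bounds
    (lam1 : ℝ) (hlam1 : 0 < lam1 ∧ lam1 ≤ 1/2)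
    (χ : ℝ → ℝ) (hχsmooth : ContDiff ℝ (⊤ : ℕ∞) χ) (hχeven : ∀ x, χ (-x) = χ x)
    (hχone : ∀ x ∈ Icc (-(lam1/2)) (lam1/2), χ x = 1)
    (hχsupp : Function.support χ ⊆ Icc (-lam1) lam1)
    (hχrange : ∀ x, 0 ≤ χ x ∧ χ x ≤ 1) :
    ∀ τ ∈ Icc (0:ℝ) 1, ∃ C : ℝ, 0 ≤ C ∧
      ∀ lam : ℝ, 0 < lam → lam ≤ 2 * lam1 → ∀ x x₁ : R2,
      (|χ (lam * dist x x₁) * J0 (lam * dist x x₁) -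
          χ (lam * (‖x‖ + 1)) * J0 (lam * (‖x‖ + 1))| ≤ C * lam ^ τ * jap x₁ ^ τ) ∧
      (|deriv (fun l : ℝ => χ (l * dist x x₁) * J0 (l * dist x x₁) -
          χ (l * (‖x‖ + 1)) * J0 (l * (‖x‖ + 1))) lam| ≤ C * jap x₁ ^ τ * lam ^ (τ - 1)) := by
  intro τ hτ
  set f : ℝ → ℝ := fun z => χ z * J0 z with hf
  have hfsmooth : ContDiff ℝ 2 f := (contDiff_infty.1 hχsmooth 2).mul contDiff_J0
  have hfsupp : HasCompactSupport f :=
    (HasCompactSupport.intro isCompact_Icc fun z hz => by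
      by_contra h
      exact hz (hχsupp h)).mul_right
  have hdf : ContDiff ℝ 1 (deriv f) :=
    (contDiff_succ_iff_deriv (n := 1).1 (by exact_mod_cast hfsmooth)).2.2
  obtain ⟨M, hM0, hM⟩ := exists_abs_sub_le_mul_rpow (hfsmooth.of_le (by norm_num)) hfsupp hτ
  obtain ⟨N, hN0, hN⟩ := exists_abs_sub_le_mul_rpow (g := fun z => z * deriv f z)
    (contDiff_id.mul hdf) hfsupp.deriv.mul_left hτ
  refine ⟨M + N, by positivity, fun lam hlam _ x x₁ => ?_⟩
  have hjap : 0 < jap x₁ := Real.sqrt_pos.2 (by positivity)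
  have hdist : |lam * dist x x₁ - lam * (‖x‖ + 1)| ≤ 2 * (lam * jap x₁) := by
    rw [← mul_sub, abs_mul, abs_of_pos hlam]
    nlinarith [abs_dist_sub_norm_add_one_le x x₁]
  have hpow : (lam * jap x₁) ^ τ = lam ^ τ * jap x₁ ^ τ := Real.mul_rpow hlam.le hjap.le
  have hMl := hM _ _ _ (mul_pos hlam hjap) hdist
  have hNl := hN _ _ _ (mul_pos hlam hjap) hdist
  rw [hpow] at hMl hNl
  have hnonneg : 0 ≤ lam ^ τ * jap x₁ ^ τ := by positivity
  constructor
  · calc _ ≤ M * (lam ^ τ * jap x₁ ^ τ) := hMl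
      _ ≤ _ := by nlinarith
  · have hd (c : ℝ) : HasDerivAt (fun l : ℝ => f (l * c)) (deriv f (lam * c) * c) lam := by
      have h1 : HasDerivAt f (deriv f (lam * c)) (lam * c) :=
        (hfsmooth.differentiable (by norm_num) _).hasDerivAt
      exact h1.comp lam (hasDerivAt_mul_const c)
    have hderiv := ((hd (dist x x₁)).sub (hd (‖x‖ + 1))).deriv
    change |deriv ((fun l : ℝ => f (l * dist x x₁)) - fun l : ℝ => f (l * (‖x‖ + 1))) lam| ≤ _
    rw [hderiv, Real.rpow_sub_one hlam.ne', ← mul_div_assoc, le_div_iff₀ hlam,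
      ← abs_of_pos hlam, ← abs_mul, abs_of_pos hlam]
    calc _ = |lam * dist x x₁ * deriv f (lam * dist x x₁) -
            lam * (‖x‖ + 1) * deriv f (lam * (‖x‖ + 1))| := by congr 1; ring
      _ ≤ N * (lam ^ τ * jap x₁ ^ τ) := hNl
      _ ≤ _ := by nlinarith
end
end

section
/- For each k ∈ (0,2) there exists a constant C_k such that for all z > 0, | ±(i/4) H0^±(z) + (1/(2π))(log(z/2) + γ) ∓ i/4 | ≤ C_k z^k. Moreover, for each k ∈ [1/2, 2) there exists a constant C_k′ such that for all z > 0, | (d/dz)[ ±(i/4) H0^±(z) + (1/(2π)) log z ] | ≤ C_k′ z^{k−1}. -/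
open MeasureTheory Real Set Complex Filter
open scoped ENNReal ComplexConjugate

noncomputable section

/-- The sum of the real power series with coefficients `a`. -/
def seriesSum (a : ℕ → ℝ) (x : ℝ) : ℝ := ∑' k, a k * x ^ k

/-- The coefficients of the derived power series. -/
def derivCoeff (a : ℕ → ℝ) (k : ℕ) : ℝ := (k + 1) * a (k + 1)

/-- The power series with coefficients `a` has infinite radius of convergence. -/
def EntireCoeff (a : ℕ → ℝ) : Prop := ∀ r : ℝ, 0 ≤ r → Summable fun k => |a k| * r ^ k

lemma EntireCoeff.summable {a : ℕ → ℝ} (ha : EntireCoeff a) (x : ℝ) :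
    Summable fun k => a k * x ^ k := by
  refine Summable.of_norm ?_
  simpa [abs_mul, abs_pow] using ha |x| (abs_nonneg x)

lemma EntireCoeff.index_mul {a : ℕ → ℝ} (ha : EntireCoeff a) :
    EntireCoeff fun k => (k : ℝ) * a k := by
  intro r hr
  refine Summable.of_nonneg_of_le (fun k => by positivity) (fun k => ?_) (ha (2 * r) (by positivity))
  have h : (k : ℝ) ≤ 2 ^ k := by exact_mod_cast Nat.lt_two_pow_self.le
  rw [abs_mul, Nat.abs_cast, mul_pow]
  calc (k : ℝ) * |a k| * r ^ k ≤ 2 ^ k * |a k| * r ^ k := by gcongr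
    _ = |a k| * (2 ^ k * r ^ k) := by ring

lemma EntireCoeff.derivCoeff {a : ℕ → ℝ} (ha : EntireCoeff a) : EntireCoeff (derivCoeff a) := by
  intro r hr
  have h := (summable_nat_add_iff 1).2 (ha.index_mul (r + 1) (by positivity))
  refine Summable.of_nonneg_of_le (fun k => by positivity) (fun k => ?_) h
  rw [_root_.derivCoeff]
  push_cast
  gcongr ?_ * ?_
  calc r ^ k ≤ (r + 1) ^ k := by gcongr; linarith
    _ ≤ (r + 1) ^ (k + 1) := pow_le_pow_right₀ (by linarith) (by omega)

lemma EntireCoeff.hasDerivAt {a : ℕ → ℝ} (ha : EntireCoeff a) (x : ℝ) :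
    HasDerivAt (seriesSum a) (seriesSum (_root_.derivCoeff a) x) x := by
  set R : ℝ := |x| + 1
  have hR : 1 ≤ R := by simp [R]
  have hsum : Summable fun k : ℕ => |(k : ℝ) * a k| * R ^ k := ha.index_mul R (by positivity)
  have key := hasDerivAt_tsum_of_isPreconnected (g := fun (k : ℕ) (y : ℝ) => a k * y ^ k)
    (g' := fun (k : ℕ) (y : ℝ) => a k * (k * y ^ (k - 1))) (t := Metric.ball 0 R)
    (y₀ := 0) (y := x) hsum Metric.isOpen_ball (convex_ball (0 : ℝ) R).isPreconnected
    (fun k y _ => (hasDerivAt_pow k y).const_mul (a k)) ?_ (by simp; positivity)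
    (ha.summable 0) (by simp [R])
  · refine key.congr_deriv ?_
    rw [Summable.tsum_eq_zero_add]
    · simp only [seriesSum, _root_.derivCoeff]
      simp
      congr 1 with k
      ring
    · refine (summable_nat_add_iff 1).1 ?_
      refine (ha.derivCoeff.summable x).congr fun k => ?_
      simp [_root_.derivCoeff]; ring
  · intro k y hy
    have hy' : |y| ≤ R := by simpa using (mem_ball_zero_iff.1 hy).le
    rw [Real.norm_eq_abs, ← mul_assoc, mul_comm (a k), abs_mul, abs_pow]
    gcongr ?_ * ?_
    calc |y| ^ (k - 1) ≤ R ^ (k - 1) := by gcongr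
      _ ≤ R ^ k := pow_le_pow_right₀ hR (by omega)

lemma seriesSum_index_mul (a : ℕ → ℝ) (ha : EntireCoeff a) (x : ℝ) :
    seriesSum (fun k => (k : ℝ) * a k) x = x * seriesSum (derivCoeff a) x := by
  rw [seriesSum, (ha.index_mul.summable x).tsum_eq_zero_add, seriesSum, ← tsum_mul_left]
  simp only [derivCoeff]
  simp
  congr 1 with k
  ring

/-- On the unit interval, an entire power series is bounded. -/
lemma EntireCoeff.exists_bound {a : ℕ → ℝ} (ha : EntireCoeff a) :
    ∃ M, ∀ x : ℝ, |x| ≤ 1 → |seriesSum a x| ≤ M := by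
  refine ⟨∑' k, |a k| * 1 ^ k, fun x hx => ?_⟩
  refine tsum_of_norm_bounded (f := fun k => a k * x ^ k) (ha 1 zero_le_one).hasSum fun k => ?_
  rw [Real.norm_eq_abs, abs_mul, abs_pow]
  gcongr

lemma seriesSum_zero (a : ℕ → ℝ) : seriesSum a 0 = a 0 := by
  rw [seriesSum, tsum_eq_single 0 (by intro k hk; simp [hk])]
  simp

/-- Value and derivative estimates for an entire power series on the unit interval. -/
lemma EntireCoeff.exists_bound_sub {a : ℕ → ℝ} (ha : EntireCoeff a) :
    ∃ M, 0 ≤ M ∧ ∀ x : ℝ, 0 ≤ x → x ≤ 1 →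
      |seriesSum a x - a 0| ≤ M * x ∧ |seriesSum (_root_.derivCoeff a) x| ≤ M := by
  obtain ⟨M, hM⟩ := ha.derivCoeff.exists_bound
  refine ⟨M, (abs_nonneg _).trans (hM 0 (by simp)), fun x hx hx1 =>
    ⟨?_, hM x (by rwa [abs_of_nonneg hx])⟩⟩
  have := (convex_Icc (0 : ℝ) 1).norm_image_sub_le_of_norm_hasDerivWithin_le
    (f := seriesSum a) (C := M) (fun y _ => (ha.hasDerivAt y).hasDerivWithinAt)
    (fun y hy => hM y (by rw [abs_of_nonneg hy.1]; exact hy.2))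
    (x := 0) (y := x) (by simp) ⟨hx, hx1⟩
  simpa [seriesSum_zero, abs_of_nonneg hx] using this

/-- Solutions of the Bessel equation of order zero, where `v` is `z` times the derivative of `y`, decay like
`z ^ (-1/2)`, and so do their derivatives. -/
lemma bessel_decay {y v : ℝ → ℝ} (hy : ∀ z, 0 < z → HasDerivAt y (v z / z) z)
    (hv : ∀ z, 0 < z → HasDerivAt v (-z * y z) z) :
    ∃ C, 0 ≤ C ∧ ∀ z, 1 ≤ z → |y z| ≤ C * z ^ (-(1 / 2) : ℝ) ∧ |v z / z| ≤ C * z ^ (-(1 / 2) : ℝ) := by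
  set E : ℝ → ℝ := fun z => v z ^ 2 / z + y z * v z / z + z * y z ^ 2 + y z ^ 2 / (2 * z) with hE
  have hE' : ∀ z, 0 < z → HasDerivAt E (-(y z ^ 2 / (2 * z ^ 2))) z := by
    intro z hz
    have h1 := hy z hz
    have h2 := hv z hz
    have h3 := hasDerivAt_id' z
    have := ((((h2.pow 2).div h3 hz.ne').add ((h1.mul h2).div h3 hz.ne')).add
      (h3.mul (h1.pow 2))).add ((h1.pow 2).div (h3.const_mul 2) (by positivity))
    refine this.congr_deriv ?_
    simp only [Pi.pow_apply, Pi.mul_apply]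
    field_simp
    ring
  have hanti : AntitoneOn E (Ici 1) := by
    refine antitoneOn_of_hasDerivWithinAt_nonpos (convex_Ici 1)
      (fun z hz => (hE' z (by have := mem_Ici.1 hz; linarith)).continuousAt.continuousWithinAt)
      (f' := fun z => -(y z ^ 2 / (2 * z ^ 2)))
      (fun z hz => (hE' z (by rw [interior_Ici] at hz; have := mem_Ioi.1 hz; linarith)).hasDerivWithinAt)
      (fun z _ => by simp only [Left.neg_nonpos_iff]; positivity)
  refine ⟨√(3 * E 1), by positivity, fun z hz => ?_⟩
  have hz0 : 0 < z := by linarith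
  have hle : E z ≤ E 1 := hanti (by simp) hz hz
  have hform : E z = (v z + y z / 2) ^ 2 / z + z * y z ^ 2 + y z ^ 2 / (4 * z) := by
    simp only [hE]; field_simp; ring
  have hp1 : 0 ≤ (v z + y z / 2) ^ 2 / z := by positivity
  have hp2 : 0 ≤ y z ^ 2 / (4 * z) := by positivity
  have hp3 : 0 ≤ z * y z ^ 2 := by positivity
  have b1 : z * y z ^ 2 ≤ 3 * E 1 := by linarith
  have b2 : v z ^ 2 / z ≤ 3 * E 1 := by
    have h : v z ^ 2 / z ≤ 2 * ((v z + y z / 2) ^ 2 / z) + 2 * (y z ^ 2 / (4 * z)) := by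
      have : 2 * ((v z + y z / 2) ^ 2 / z) + 2 * (y z ^ 2 / (4 * z)) - v z ^ 2 / z
          = (v z + y z) ^ 2 / z := by field_simp; ring
      have : 0 ≤ (v z + y z) ^ 2 / z := by positivity
      linarith
    linarith
  have hrt : z ^ (-(1 / 2) : ℝ) = (√z)⁻¹ := by
    rw [Real.rpow_neg hz0.le, Real.sqrt_eq_rpow]
  have conv : ∀ t : ℝ, z * t ^ 2 ≤ 3 * E 1 → |t| ≤ √(3 * E 1) * z ^ (-(1 / 2) : ℝ) := by
    intro t ht
    rw [hrt, ← div_eq_mul_inv, le_div_iff₀ (by positivity)]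
    refine Real.le_sqrt_of_sq_le ?_
    rw [mul_pow, sq_abs, Real.sq_sqrt hz0.le]
    linarith
  refine ⟨conv _ b1, conv _ ?_⟩
  convert b2 using 1
  field_simp

/-- The coefficients of `J₀` as a power series in `(z / 2) ^ 2`. -/
def besselCoeff (k : ℕ) : ℝ := (-1) ^ k / (k.factorial : ℝ) ^ 2

/-- The coefficients of the regular part of `Y₀` as a power series in `(z / 2) ^ 2`. -/
def neumannCoeff (k : ℕ) : ℝ := -((-1) ^ k * (harmonic k : ℝ) / (k.factorial : ℝ) ^ 2)

lemma entireCoeff_of_le {a : ℕ → ℝ} (h : ∀ k, |a k| ≤ 1 / k.factorial) : EntireCoeff a := by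
  intro r hr
  refine Summable.of_nonneg_of_le (fun k => by positivity) (fun k => ?_)
    (Real.summable_pow_div_factorial r)
  calc |a k| * r ^ k ≤ 1 / k.factorial * r ^ k := by gcongr; exact h k
    _ = r ^ k / k.factorial := by ring

lemma entireCoeff_besselCoeff : EntireCoeff besselCoeff := by
  refine entireCoeff_of_le fun k => ?_
  have h : (1 : ℝ) ≤ k.factorial := by exact_mod_cast k.factorial_pos
  rw [besselCoeff, abs_div, abs_pow, abs_neg, abs_one, one_pow, abs_of_pos (by positivity)]
  gcongr
  nlinarith

lemma harmonic_nonneg (k : ℕ) : 0 ≤ harmonic k :=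
  Finset.sum_nonneg fun _ _ => by positivity

lemma harmonic_le_factorial (k : ℕ) : harmonic k ≤ k.factorial := by
  have h : harmonic k ≤ k := by
    induction k with
    | zero => simp
    | succ k ih =>
      rw [harmonic_succ]
      have : ((k + 1 : ℕ) : ℚ)⁻¹ ≤ 1 := inv_le_one_of_one_le₀ (by exact_mod_cast Nat.succ_pos k)
      push_cast at this ⊢
      linarith
  exact h.trans (by exact_mod_cast k.self_le_factorial)

lemma entireCoeff_neumannCoeff : EntireCoeff neumannCoeff := by
  refine entireCoeff_of_le fun k => ?_
  have h : (0 : ℝ) < k.factorial := by exact_mod_cast k.factorial_pos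
  have h0 : (0 : ℝ) ≤ (harmonic k : ℝ) := by exact_mod_cast harmonic_nonneg k
  have h1 : (harmonic k : ℝ) ≤ k.factorial := by exact_mod_cast harmonic_le_factorial k
  rw [neumannCoeff, abs_neg, abs_div, abs_mul, abs_pow, abs_neg, abs_one, one_pow, one_mul,
    abs_of_pos (by positivity : (0 : ℝ) < (k.factorial : ℝ) ^ 2), abs_of_nonneg h0,
    div_le_div_iff₀ (by positivity) h]
  nlinarith

lemma derivCoeff_index_mul_besselCoeff :
    derivCoeff (fun k => (k : ℝ) * besselCoeff k) = fun k => -besselCoeff k := by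
  funext k
  have : (k.factorial : ℝ) ≠ 0 := by exact_mod_cast k.factorial_ne_zero
  have : (k + 1 : ℝ) ≠ 0 := by positivity
  simp only [derivCoeff, besselCoeff, Nat.factorial_succ]
  push_cast
  field_simp
  ring

lemma derivCoeff_index_mul_neumannCoeff :
    derivCoeff (fun k => (k : ℝ) * neumannCoeff k) =
      fun k => -neumannCoeff k - derivCoeff besselCoeff k := by
  funext k
  have : (k.factorial : ℝ) ≠ 0 := by exact_mod_cast k.factorial_ne_zero
  have : (k + 1 : ℝ) ≠ 0 := by positivity
  simp only [derivCoeff, besselCoeff, neumannCoeff, Nat.factorial_succ, harmonic_succ]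
  push_cast
  field_simp
  ring

lemma J0_eq (z : ℝ) : J0 z = seriesSum besselCoeff ((z / 2) ^ 2) := by
  simp only [J0, seriesSum, besselCoeff]
  congr 1 with k
  rw [pow_mul]
  ring

/-- The function `π / 2 * Y₀`. -/
def neumann (z : ℝ) : ℝ :=
  (Real.log (z / 2) + Real.eulerMascheroniConstant) * J0 z + seriesSum neumannCoeff ((z / 2) ^ 2)

lemma Y0_eq (z : ℝ) : Y0 z = 2 / π * neumann z := by
  rw [Y0, neumann, seriesSum,
    (entireCoeff_neumannCoeff.summable ((z / 2) ^ 2)).tsum_eq_zero_add]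
  simp only [neumannCoeff]
  simp only [harmonic_zero, Rat.cast_zero, mul_zero, zero_div, neg_zero, zero_mul, zero_add]
  congr 3 with k
  rw [← pow_mul]
  ring

lemma hasDerivAt_seriesSum_half_sq {a : ℕ → ℝ} (ha : EntireCoeff a) (z : ℝ) :
    HasDerivAt (fun w => seriesSum a ((w / 2) ^ 2))
      (z / 2 * seriesSum (derivCoeff a) ((z / 2) ^ 2)) z := by
  have h := ((hasDerivAt_id' z).div_const 2).pow 2
  refine ((ha.hasDerivAt ((z / 2) ^ 2)).comp z h).congr_deriv ?_
  ring

/-- The function `z` times the derivative of `J₀`. -/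
def besselFlux (z : ℝ) : ℝ := 2 * seriesSum (fun k => (k : ℝ) * besselCoeff k) ((z / 2) ^ 2)

lemma hasDerivAt_J0' (z : ℝ) :
    HasDerivAt J0 (z / 2 * seriesSum (derivCoeff besselCoeff) ((z / 2) ^ 2)) z :=
  (hasDerivAt_seriesSum_half_sq entireCoeff_besselCoeff z).congr_of_eventuallyEq
    (Eventually.of_forall J0_eq)

lemma hasDerivAt_J0 {z : ℝ} (hz : 0 < z) : HasDerivAt J0 (besselFlux z / z) z := by
  refine (hasDerivAt_J0' z).congr_deriv ?_
  rw [besselFlux, seriesSum_index_mul _ entireCoeff_besselCoeff]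
  field_simp

lemma hasDerivAt_besselFlux (z : ℝ) : HasDerivAt besselFlux (-z * J0 z) z := by
  refine ((hasDerivAt_seriesSum_half_sq entireCoeff_besselCoeff.index_mul z).const_mul
    2).congr_deriv ?_
  rw [derivCoeff_index_mul_besselCoeff, J0_eq]
  simp only [seriesSum, neg_mul, tsum_neg]
  ring

/-- The function `z` times the derivative of `π / 2 * Y₀`. -/
def neumannFlux (z : ℝ) : ℝ :=
  J0 z + (Real.log (z / 2) + Real.eulerMascheroniConstant) * besselFlux z +
    2 * seriesSum (fun k => (k : ℝ) * neumannCoeff k) ((z / 2) ^ 2)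

lemma hasDerivAt_log_half {z : ℝ} (hz : 0 < z) :
    HasDerivAt (fun w => Real.log (w / 2) + Real.eulerMascheroniConstant) (1 / z) z := by
  refine ((((hasDerivAt_id' z).div_const 2).log (by positivity)).add_const _).congr_deriv ?_
  field_simp

lemma hasDerivAt_neumann' {z : ℝ} (hz : 0 < z) :
    HasDerivAt neumann (J0 z / z + (Real.log (z / 2) + Real.eulerMascheroniConstant) *
      (z / 2 * seriesSum (derivCoeff besselCoeff) ((z / 2) ^ 2)) +
      z / 2 * seriesSum (derivCoeff neumannCoeff) ((z / 2) ^ 2)) z := by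
  refine (((hasDerivAt_log_half hz).mul (hasDerivAt_J0' z)).add
    (hasDerivAt_seriesSum_half_sq entireCoeff_neumannCoeff z)).congr_deriv ?_
  ring

lemma hasDerivAt_neumann {z : ℝ} (hz : 0 < z) : HasDerivAt neumann (neumannFlux z / z) z := by
  refine (hasDerivAt_neumann' hz).congr_deriv ?_
  rw [neumannFlux, besselFlux, seriesSum_index_mul _ entireCoeff_besselCoeff,
    seriesSum_index_mul _ entireCoeff_neumannCoeff]
  field_simp

lemma hasDerivAt_neumannFlux {z : ℝ} (hz : 0 < z) :
    HasDerivAt neumannFlux (-z * neumann z) z := by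
  refine (((hasDerivAt_J0' z).add ((hasDerivAt_log_half hz).mul (hasDerivAt_besselFlux z))).add
    ((hasDerivAt_seriesSum_half_sq entireCoeff_neumannCoeff.index_mul z).const_mul
    2)).congr_deriv ?_
  have h : seriesSum (derivCoeff fun k => (k : ℝ) * neumannCoeff k) ((z / 2) ^ 2) =
      -seriesSum neumannCoeff ((z / 2) ^ 2) -
        seriesSum (derivCoeff besselCoeff) ((z / 2) ^ 2) := by
    rw [derivCoeff_index_mul_neumannCoeff, seriesSum, seriesSum, seriesSum, ← tsum_neg,
      ← Summable.tsum_sub (entireCoeff_neumannCoeff.summable _).neg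
        (entireCoeff_besselCoeff.derivCoeff.summable _)]
    congr 1 with k
    ring
  rw [h, neumann, besselFlux, seriesSum_index_mul _ entireCoeff_besselCoeff]
  field_simp
  ring

/-- The norm of `± (i/4) s + t / (2π)` for real `s` and `t`. -/
lemma norm_hankel_combination_le {ε : ℝ} (hε : ε = 1 ∨ ε = -1) (s t : ℝ) :
    ‖(ε : ℂ) * (Complex.I / 4) * s + ((1 / (2 * π) * t : ℝ) : ℂ)‖ ≤ |s| + |t| := by
  have hp : 1 / (2 * π) ≤ 1 := by
    rw [div_le_one (by positivity)]; linarith [Real.pi_gt_three]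
  have he : |ε| = 1 := by rcases hε with rfl | rfl <;> simp
  refine (norm_add_le _ _).trans (add_le_add ?_ ?_)
  · rw [norm_mul, norm_mul, norm_div, Complex.norm_I, Complex.norm_real, Complex.norm_real,
      Real.norm_eq_abs, Real.norm_eq_abs, he]
    norm_num
    linarith [abs_nonneg s]
  · rw [Complex.norm_real, Real.norm_eq_abs, abs_mul, abs_of_pos (by positivity)]
    exact mul_le_of_le_one_left (abs_nonneg t) hp

lemma hankel_combination {ε : ℝ} (hε : ε = 1 ∨ ε = -1) (z : ℝ) :
    (ε : ℂ) * (Complex.I / 4) * H0 ε z =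
      (ε : ℂ) * (Complex.I / 4) * J0 z - ((1 / (2 * π) * neumann z : ℝ) : ℂ) := by
  have he : (ε : ℂ) * ε = 1 := by rcases hε with rfl | rfl <;> simp
  have hpi : (π : ℂ) ≠ 0 := by exact_mod_cast Real.pi_ne_zero
  rw [H0, Y0_eq]
  push_cast
  field_simp
  linear_combination (4 * (neumann z : ℂ) * Complex.I ^ 2) * he + 4 * (neumann z : ℂ) * Complex.I_sq

lemma abs_log_half_add_le (z : ℝ) (hz : 0 < z) :
    |Real.log (z / 2) + Real.eulerMascheroniConstant| ≤ |Real.log z| + 2 := by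
  rw [Real.log_div hz.ne' (by norm_num)]
  have h1 := Real.one_half_lt_eulerMascheroniConstant
  have h2 := Real.eulerMascheroniConstant_lt_two_thirds
  have h3 := Real.log_two_gt_d9
  have h4 := Real.log_two_lt_d9
  have h5 := neg_abs_le (Real.log z)
  have h6 := le_abs_self (Real.log z)
  rw [abs_le]
  constructor <;> linarith

/-- Estimates near the origin for the regularised Bessel functions and their derivatives. -/
lemma exists_bound_near_zero :
    ∃ M, 0 ≤ M ∧ ∀ z : ℝ, 0 < z → z ≤ 1 →
      (|J0 z - 1| + |Real.log (z / 2) + Real.eulerMascheroniConstant - neumann z| ≤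
        M * ((|Real.log z| + 4) * z ^ 2)) ∧
      |besselFlux z / z| + |1 / z - neumannFlux z / z| ≤ M * ((|Real.log z| + 5) * z) := by
  obtain ⟨A, hA, hJ⟩ := entireCoeff_besselCoeff.exists_bound_sub
  obtain ⟨B, hB, hS⟩ := entireCoeff_neumannCoeff.exists_bound_sub
  refine ⟨A + B, by positivity, fun z hz hz1 => ?_⟩
  obtain ⟨hJ1, hJ2⟩ := hJ ((z / 2) ^ 2) (by positivity) (by nlinarith)
  obtain ⟨hS1, hS2⟩ := hS ((z / 2) ^ 2) (by positivity) (by nlinarith)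
  have hL := abs_log_half_add_le z hz
  have eJ := (hasDerivAt_J0 hz).unique (hasDerivAt_J0' z)
  have eN := (hasDerivAt_neumann hz).unique (hasDerivAt_neumann' hz)
  rw [← J0_eq, show besselCoeff 0 = 1 by simp [besselCoeff]] at hJ1
  rw [show neumannCoeff 0 = 0 by simp [neumannCoeff], sub_zero] at hS1
  rw [eJ, eN, neumann]
  set L := Real.log (z / 2) + Real.eulerMascheroniConstant
  set s := seriesSum neumannCoeff ((z / 2) ^ 2)
  set p := seriesSum (derivCoeff besselCoeff) ((z / 2) ^ 2)
  set q := seriesSum (derivCoeff neumannCoeff) ((z / 2) ^ 2)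
  set l := |Real.log z|
  have hl : 0 ≤ l := abs_nonneg _
  have hz2 : 0 < z ^ 2 := by positivity
  have hJ3 : |J0 z - 1| ≤ A * z ^ 2 := hJ1.trans (by gcongr; nlinarith)
  have hS3 : |s| ≤ B * z ^ 2 := hS1.trans (by gcongr; nlinarith)
  have hp : |z / 2 * p| ≤ A * z := by
    rw [abs_mul, abs_of_pos (by positivity : 0 < z / 2)]; nlinarith [mul_le_mul_of_nonneg_left hJ2 hz.le]
  have hq : |z / 2 * q| ≤ B * z := by
    rw [abs_mul, abs_of_pos (by positivity : 0 < z / 2)]; nlinarith [mul_le_mul_of_nonneg_left hS2 hz.le]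
  constructor
  · have h1 : |L - (L * J0 z + s)| ≤ |L| * |J0 z - 1| + |s| := by
      rw [← abs_mul, show L - (L * J0 z + s) = -(L * (J0 z - 1)) - s by ring]
      exact (abs_sub _ _).trans (by rw [abs_neg])
    have h2 : |L| * |J0 z - 1| ≤ (l + 2) * (A * z ^ 2) := by gcongr
    nlinarith [mul_nonneg hA hz2.le, mul_nonneg hB hz2.le, mul_nonneg hl (mul_nonneg hB hz2.le)]
  · have h1 : |1 / z - (J0 z / z + L * (z / 2 * p) + z / 2 * q)| ≤
        |J0 z - 1| / z + |L| * |z / 2 * p| + |z / 2 * q| := by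
      rw [← abs_mul, ← abs_of_pos hz, ← abs_div, abs_of_pos hz,
        show 1 / z - (J0 z / z + L * (z / 2 * p) + z / 2 * q) =
          -((J0 z - 1) / z + L * (z / 2 * p) + z / 2 * q) by ring, abs_neg]
      exact abs_add_three _ _ _
    have h2 : |L| * |z / 2 * p| ≤ (l + 2) * (A * z) := by gcongr
    have h3 : |J0 z - 1| / z ≤ A * z := by rw [div_le_iff₀ hz]; nlinarith
    nlinarith [mul_nonneg hA hz.le, mul_nonneg hB hz.le, mul_nonneg hl (mul_nonneg hB hz.le)]

/-- Estimates at infinity for the regularised Bessel functions and their derivatives. -/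
lemma exists_bound_at_infinity :
    ∃ M, 0 ≤ M ∧ ∀ z : ℝ, 1 ≤ z →
      (|J0 z - 1| + |Real.log (z / 2) + Real.eulerMascheroniConstant - neumann z| ≤
        M + |Real.log z|) ∧
      |besselFlux z / z| + |1 / z - neumannFlux z / z| ≤ M * z ^ (-(1 / 2) : ℝ) := by
  obtain ⟨A, hA, hJ⟩ := bessel_decay (fun z hz => hasDerivAt_J0 hz)
    (fun z _ => hasDerivAt_besselFlux z)
  obtain ⟨B, hB, hN⟩ := bessel_decay (fun z hz => hasDerivAt_neumann hz)
    (fun z hz => hasDerivAt_neumannFlux hz)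
  refine ⟨A + B + 3, by positivity, fun z hz => ?_⟩
  have hz0 : 0 < z := by linarith
  obtain ⟨hJ1, hJ2⟩ := hJ z hz
  obtain ⟨hN1, hN2⟩ := hN z hz
  have hL := abs_log_half_add_le z hz0
  have hw : z ^ (-(1 / 2) : ℝ) ≤ 1 := Real.rpow_le_one_of_one_le_of_nonpos hz (by norm_num)
  have hw0 : 0 ≤ z ^ (-(1 / 2) : ℝ) := by positivity
  have hi : |1 / z| ≤ z ^ (-(1 / 2) : ℝ) := by
    rw [abs_of_pos (by positivity), one_div, ← Real.rpow_neg_one]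
    exact Real.rpow_le_rpow_of_exponent_le hz (by norm_num)
  constructor
  · have h1 := abs_sub (J0 z) 1
    have h2 := abs_sub (Real.log (z / 2) + Real.eulerMascheroniConstant) (neumann z)
    rw [abs_one] at h1
    nlinarith
  · have h1 := abs_sub (1 / z) (neumannFlux z / z)
    nlinarith

/-- Near the origin, a logarithm is absorbed by any positive power. -/
lemma abs_log_add_mul_sq_le {k z : ℝ} (hk : k < 2) (hz : 0 < z) (hz1 : z ≤ 1) :
    (|Real.log z| + 5) * z ^ 2 ≤ (1 / (2 - k) + 5) * z ^ k := by
  have h1 := (Real.abs_log_mul_self_rpow_lt z (2 - k) hz hz1 (by linarith)).le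
  have h2 : z ^ (2 - k) ≤ 1 := Real.rpow_le_one hz.le hz1 (by linarith)
  have h3 : z ^ 2 = z ^ (2 - k) * z ^ k := by
    rw [← Real.rpow_add hz, sub_add_cancel, Real.rpow_two]
  rw [abs_mul, abs_of_pos (Real.rpow_pos_of_pos hz _)] at h1
  rw [h3, ← mul_assoc]
  gcongr
  linarith

/-- **Small-argument expansion bounds for the Hankel functions** (from Lemma `lem:M_exp`).
For each `k ∈ (0,2)` there is `C_k` with
`|±(i/4)H₀^±(z) + (1/2π)(log(z/2)+γ) ∓ i/4| ≤ C_k z^k` for all `z > 0`, and for each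
`k ∈ [1/2,2)` there is `C_k'` with
`|(d/dz)[±(i/4)H₀^±(z) + (1/2π) log z]| ≤ C_k' z^{k-1}` for all `z > 0`. -/
theorem hankel_expansion_bounds :
    (∀ k : ℝ, 0 < k → k < 2 → ∀ ε : ℝ, ε = 1 ∨ ε = -1 → ∃ C : ℝ,
      ∀ z : ℝ, 0 < z →
        ‖(ε : ℂ) * (Complex.I / 4) * H0 ε z +
            (((1/(2*π)) * (Real.log (z/2) + Real.eulerMascheroniConstant) : ℝ) : ℂ) -
            (ε : ℂ) * Complex.I / 4‖ ≤ C * z ^ k) ∧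
    (∀ k : ℝ, 1/2 ≤ k → k < 2 → ∀ ε : ℝ, ε = 1 ∨ ε = -1 → ∃ C : ℝ,
      ∀ z : ℝ, 0 < z →
        ‖deriv (fun w : ℝ => (ε : ℂ) * (Complex.I / 4) * H0 ε w +
            (((1/(2*π)) * Real.log w : ℝ) : ℂ)) z‖ ≤ C * z ^ (k - 1)) := by
  constructor
  · intro k hk hk2 ε hε
    obtain ⟨M, hM, hsmall⟩ := exists_bound_near_zero
    obtain ⟨N, hN, hlarge⟩ := exists_bound_at_infinity
    have hc : 0 < 1 / (2 - k) := one_div_pos.2 (by linarith)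
    refine ⟨M * (1 / (2 - k) + 5) + (N + 1 / k), fun z hz => ?_⟩
    have hzk : 0 < z ^ k := Real.rpow_pos_of_pos hz k
    have hrepr : (ε : ℂ) * (Complex.I / 4) * H0 ε z +
        (((1/(2*π)) * (Real.log (z/2) + Real.eulerMascheroniConstant) : ℝ) : ℂ) -
        (ε : ℂ) * Complex.I / 4 = (ε : ℂ) * (Complex.I / 4) * ((J0 z - 1 : ℝ) : ℂ) +
        ((1 / (2 * π) * (Real.log (z/2) + Real.eulerMascheroniConstant - neumann z) : ℝ) : ℂ) := by
      rw [hankel_combination hε]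
      push_cast
      ring
    rw [hrepr]
    refine (norm_hankel_combination_le hε _ _).trans ?_
    rcases le_total z 1 with hz1 | hz1
    · have h := (hsmall z hz hz1).1
      have h' := abs_log_add_mul_sq_le hk2 hz hz1
      calc _ ≤ M * ((|Real.log z| + 4) * z ^ 2) := h
        _ ≤ M * ((|Real.log z| + 5) * z ^ 2) := by gcongr; norm_num
        _ ≤ M * ((1 / (2 - k) + 5) * z ^ k) := by gcongr
        _ ≤ _ := by
          have : 0 ≤ (N + 1 / k) * z ^ k := by positivity
          linarith
    · have h := (hlarge z hz1).1
      have h1 : 1 ≤ z ^ k := Real.one_le_rpow hz1 hk.le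
      have h2 := Real.log_le_rpow_div hz.le hk
      rw [abs_of_nonneg (Real.log_nonneg hz1)] at h
      have h3 : 0 ≤ M * (1 / (2 - k) + 5) * z ^ k := by positivity
      have h4 : N ≤ N * z ^ k := le_mul_of_one_le_right hN h1
      calc _ ≤ _ := h
        _ ≤ N * z ^ k + z ^ k / k := add_le_add h4 h2
        _ ≤ _ := by
          have : (N + 1 / k) * z ^ k = N * z ^ k + z ^ k / k := by ring
          linarith
  · intro k hk hk2 ε hε
    obtain ⟨M, hM, hsmall⟩ := exists_bound_near_zero
    obtain ⟨N, hN, hlarge⟩ := exists_bound_at_infinity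
    have hc : 0 < 1 / (2 - k) := one_div_pos.2 (by linarith)
    refine ⟨M * (1 / (2 - k) + 5) + N, fun z hz => ?_⟩
    have hzk : 0 < z ^ (k - 1) := Real.rpow_pos_of_pos hz _
    have hderiv : HasDerivAt (fun w : ℝ => (ε : ℂ) * (Complex.I / 4) * H0 ε w +
        (((1/(2*π)) * Real.log w : ℝ) : ℂ))
        ((ε : ℂ) * (Complex.I / 4) * ((besselFlux z / z : ℝ) : ℂ) +
          ((1 / (2 * π) * (1 / z - neumannFlux z / z) : ℝ) : ℂ)) z := by
      have h1 := ((hasDerivAt_J0 hz).ofReal_comp).const_mul ((ε : ℂ) * (Complex.I / 4))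
      have h2 := (((Real.hasDerivAt_log hz.ne').sub (hasDerivAt_neumann hz)).const_mul
        (1 / (2 * π))).ofReal_comp
      rw [← one_div] at h2
      refine (h1.add h2).congr_of_eventuallyEq (Eventually.of_forall fun w => ?_)
      simp only [hankel_combination hε, Pi.add_apply, Pi.sub_apply]
      push_cast
      ring
    rw [hderiv.deriv]
    refine (norm_hankel_combination_le hε _ _).trans ?_
    rcases le_total z 1 with hz1 | hz1
    · have h := (hsmall z hz hz1).2
      have h' : (|Real.log z| + 5) * z ≤ (1 / (2 - k) + 5) * z ^ (k - 1) := by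
        rw [Real.rpow_sub_one hz.ne', ← mul_div_assoc, le_div_iff₀ hz]
        linarith [abs_log_add_mul_sq_le hk2 hz hz1]
      calc _ ≤ _ := h
        _ ≤ M * ((1 / (2 - k) + 5) * z ^ (k - 1)) := by gcongr
        _ ≤ _ := by
          have : 0 ≤ N * z ^ (k - 1) := by positivity
          linarith
    · have h := (hlarge z hz1).2
      have h1 : z ^ (-(1 / 2) : ℝ) ≤ z ^ (k - 1) :=
        Real.rpow_le_rpow_of_exponent_le hz1 (by linarith)
      calc _ ≤ _ := h
        _ ≤ N * z ^ (k - 1) := by gcongr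
        _ ≤ _ := by
          have : 0 ≤ M * (1 / (2 - k) + 5) * z ^ (k - 1) := by positivity
          linarith
end
end
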